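/- Let K be a field, m ≥ 2, n ≥ 2, and q_1, q_2, … ∈ K^* with indices mod m. Consider the m linear equations λ_{i+1} = (-1)^{n+1} λ_i + (q_{i+1} q_{i+2} ⋯ q_{i+n-1}) μ_i − μ_{i-1} for i = 0,…,m−1 (indices mod m), in unknowns λ_0,…,λ_{m-1}, μ_0,…,μ_{m-1}. If n is odd or char K = 2, then summing the equations yields the single dependency Σ_{i=0}^{m-1} ((q_{i+1}⋯q_{i+n-1}) − 1) μ_i = 0 among the μ_i, and the solution space has dimension m when Σ_{i}((q_{i+1}⋯q_{i+n-1}) − 1) μ_i = 0 is a nontrivial linear condition, i.e., the λ_i can be solved from λ_0 and the μ's, with the μ's constrained by that one relation and λ_0 free. -/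

import Mathlib

theorem sum_zmod_eq_range {K : Type*} [AddCommMonoid K] (m : ℕ) [NeZero m] (d : ZMod m → K) :
    ∑ i : ZMod m, d i = ∑ j ∈ Finset.range m, d (j : ZMod m) := by
  refine Finset.sum_bij' (fun i _ => i.val) (fun j _ => (j : ZMod m)) ?_ ?_ ?_ ?_ ?_
  · intro i _
    exact Finset.mem_range.2 (ZMod.val_lt i)
  · intro j _
    exact Finset.mem_univ _
  · intro i _
    exact ZMod.natCast_zmod_val i
  · intro j hj
    exact ZMod.val_cast_of_lt (Finset.mem_range.1 hj)
  · intro i _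
    simp

theorem sum_shift_add {K : Type*} [AddCommMonoid K] (m : ℕ) [NeZero m] (f : ZMod m → K) :
    ∑ i : ZMod m, f (i + 1) = ∑ i : ZMod m, f i :=
  Equiv.sum_comp (Equiv.addRight (1 : ZMod m)) f

theorem sum_shift_sub {K : Type*} [AddCommMonoid K] (m : ℕ) [NeZero m] (f : ZMod m → K) :
    ∑ i : ZMod m, f (i - 1) = ∑ i : ZMod m, f i :=
  Equiv.sum_comp (Equiv.subRight (1 : ZMod m)) f

theorem cyclic_solve {K : Type*} [AddCommGroup K] (m : ℕ) [NeZero m] (hm : 2 ≤ m)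
    (d : ZMod m → K) (hd : ∑ i : ZMod m, d i = 0) (c : K) :
    ∃! lam : ZMod m → K, lam 0 = c ∧ ∀ i : ZMod m, lam (i + 1) = lam i + d i := by
  refine ⟨fun i => c + ∑ j ∈ Finset.range i.val, d (j : ZMod m), ⟨by simp, ?_⟩, ?_⟩
  · intro i
    have h1 : (i + 1).val = (i.val + 1) % m := by
      rw [ZMod.val_add, ZMod.val_one'' (by omega)]
    have h2 : ∑ j ∈ Finset.range (i + 1).val, d (j : ZMod m)
        = ∑ j ∈ Finset.range (i.val + 1), d (j : ZMod m) := by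
      have hlt := ZMod.val_lt i
      rcases Nat.lt_or_ge (i.val + 1) m with h | h
      · rw [h1, Nat.mod_eq_of_lt h]
      · have h3 : i.val + 1 = m := by omega
        rw [h1, h3, Nat.mod_self, ← sum_zmod_eq_range, hd]
        simp
    show c + _ = c + _ + _
    rw [h2, Finset.sum_range_succ, ZMod.natCast_zmod_val, add_assoc]
  · rintro lam ⟨h0, hs⟩
    have key : ∀ k : ℕ, lam (k : ZMod m) = c + ∑ j ∈ Finset.range k, d (j : ZMod m) := by
      intro k
      induction k with
      | zero => simp [h0]
      | succ k ih => rw [Nat.cast_succ, hs, ih, Finset.sum_range_succ, add_assoc]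
    funext i
    have := key i.val
    rwa [ZMod.natCast_zmod_val] at this


/-- The `r = 1` case of the kernel computation: consider the `m` linear equations
`λ_{i+1} = (-1)^{n+1} λ_i + (q_{i+1} ⋯ q_{i+n-1}) μ_i − μ_{i-1}` (indices mod `m`).
If `n` is odd or `char K = 2`, then summing them yields the single dependency
`Σ_i ((q_{i+1} ⋯ q_{i+n-1}) − 1) μ_i = 0` among the `μ_i`; conversely, given any `μ`
satisfying this relation, the `λ_i` are uniquely determined by the free choice of
`λ_0` (so the solution space has dimension `m`). -/
theorem stmt12 (K : Type*) [Field K] (m : ℕ) [NeZero m] (hm : 2 ≤ m) (n : ℕ) (hn : 2 ≤ n)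
    (q : ZMod m → K) (hq : ∀ i, q i ≠ 0)
    (hpar : Odd n ∨ ringChar K = 2) :
    (∀ lam μ : ZMod m → K,
      (∀ i : ZMod m, lam (i + 1) = (-1 : K) ^ (n + 1) * lam i
          + (∏ k ∈ Finset.range (n - 1), q (i + 1 + (k : ZMod m))) * μ i - μ (i - 1)) →
      ∑ i : ZMod m, ((∏ k ∈ Finset.range (n - 1), q (i + 1 + (k : ZMod m))) - 1) * μ i = 0) ∧
    (∀ μ : ZMod m → K,
      (∑ i : ZMod m, ((∏ k ∈ Finset.range (n - 1), q (i + 1 + (k : ZMod m))) - 1) * μ i = 0) →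
      ∀ c : K, ∃! lam : ZMod m → K, lam 0 = c ∧
        ∀ i : ZMod m, lam (i + 1) = (-1 : K) ^ (n + 1) * lam i
          + (∏ k ∈ Finset.range (n - 1), q (i + 1 + (k : ZMod m))) * μ i - μ (i - 1)) := by
  have hsgn : (-1 : K) ^ (n + 1) = 1 := by
    rcases hpar with h | h
    · exact (h.add_one).neg_one_pow
    · haveI : CharP K 2 := ringChar.of_eq h
      rw [CharTwo.neg_eq, one_pow]
  simp only [hsgn, one_mul]
  generalize hP : (fun i : ZMod m => ∏ k ∈ Finset.range (n - 1), q (i + 1 + (k : ZMod m))) = P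
  have hP' : ∀ i : ZMod m, ∏ k ∈ Finset.range (n - 1), q (i + 1 + (k : ZMod m)) = P i :=
    fun i => congrFun hP i
  simp only [hP']
  have hsum : ∀ μ : ZMod m → K, ∑ i : ZMod m, (P i - 1) * μ i
      = ∑ i : ZMod m, (P i * μ i - μ (i - 1)) := by
    intro μ
    rw [Finset.sum_sub_distrib, sum_shift_sub, ← Finset.sum_sub_distrib]
    exact Finset.sum_congr rfl fun i _ => by ring
  constructor
  · intro lam μ h
    rw [hsum]
    have h1 : ∀ i : ZMod m, P i * μ i - μ (i - 1) = lam (i + 1) - lam i := by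
      intro i
      rw [h i]
      ring
    rw [Finset.sum_congr rfl fun i _ => h1 i, Finset.sum_sub_distrib, sum_shift_add, sub_self]
  · intro μ h c
    rw [hsum] at h
    have := cyclic_solve m hm (fun i => P i * μ i - μ (i - 1)) h c
    simpa only [add_sub_assoc] using this
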